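/- arXiv:2501.17136 — 2 statements merged into one kernel-verified Lean document; each statement's English description precedes it below -/
import Mathlib

section
/- Let m ≥ 1, k = 2m+1, and let a_1, …, a_k be nonzero integers. Then for every integer r ≥ 3 the equation a_1x_1 + ⋯ + a_kx_k = 0 is r-uncommon over the integers: there exist δ > 0 and N₀ such that for every n ≥ N₀ there is a coloring c : {1,…,n} → {1,…,r} with r^{k−1} · #{(x_1,…,x_k) ∈ {1,…,n}^k : a_1x_1 + ⋯ + a_kx_k = 0 and c(x_1) = ⋯ = c(x_k)} ≤ (1 − δ) · #{(x_1,…,x_k) ∈ {1,…,n}^k : a_1x_1 + ⋯ + a_kx_k = 0}. -/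
open Finset

/-- The solutions of `∑ i, a i * x i = 0` with all entries in `{1, …, n}`. -/
noncomputable def boxSolutions {k : ℕ} (a : Fin k → ℤ) (n : ℕ) : Finset (Fin k → ℤ) :=
  (Fintype.piFinset fun _ : Fin k => Icc (1 : ℤ) n).filter (fun x => ∑ i, a i * x i = 0)

lemma mem_boxSolutions {k : ℕ} {a : Fin k → ℤ} {n : ℕ} {x : Fin k → ℤ} :
    x ∈ boxSolutions a n ↔ (∀ i, 1 ≤ x i ∧ x i ≤ n) ∧ ∑ i, a i * x i = 0 := by
  simp [boxSolutions, Fintype.mem_piFinset]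

/-- A set of points of the box that are determined by all but two coordinates is small. -/
lemma card_le_pow_of_determined {k n : ℕ} {T : Finset (Fin k → ℤ)} {l j : Fin k} (hlj : l ≠ j)
    (hbox : ∀ x ∈ T, ∀ i, 1 ≤ x i ∧ x i ≤ n)
    (hdet : ∀ x ∈ T, ∀ y ∈ T, (∀ i, i ≠ l → i ≠ j → x i = y i) → x = y) :
    T.card ≤ n ^ (k - 2) := by
  classical
  let U : Finset (Fin k) := (univ.erase l).erase j
  have hU : U.card = k - 2 := by
    simp only [U]
    rw [card_erase_of_mem (by simp [hlj.symm]), card_erase_of_mem (by simp)]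
    simp
    omega
  have hle : T.card ≤ (Fintype.piFinset fun _ : U => Icc (1 : ℤ) n).card := by
    apply card_le_card_of_injOn (fun x (i : U) => x i)
    · intro x hx
      exact mem_coe.2 (Fintype.mem_piFinset.2 fun i => mem_Icc.2 (hbox x hx i))
    · intro x hx y hy hxy
      refine hdet x hx y hy fun i hil hij => ?_
      exact congrFun hxy ⟨i, by simp [U, hil, hij]⟩
  simpa [hU] using hle

lemma eq_of_sum_mul_eq {k : ℕ} {a : Fin k → ℤ} (ha : ∀ i, a i ≠ 0) {x y : Fin k → ℤ}
    (hx : ∑ i, a i * x i = 0) (hy : ∑ i, a i * y i = 0) (l : Fin k)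
    (h : ∀ i, i ≠ l → x i = y i) : x = y := by
  rw [← add_sum_erase _ _ (mem_univ l)] at hx hy
  have hrest : ∑ i ∈ univ.erase l, a i * x i = ∑ i ∈ univ.erase l, a i * y i :=
    sum_congr rfl fun i hi => by rw [h i (ne_of_mem_erase hi)]
  have hl : x l = y l := mul_left_cancel₀ (ha l) (by linarith)
  funext i
  by_cases hi : i = l
  · rw [hi, hl]
  · exact h i hi

lemma card_boxSolutions_coord_eq {k : ℕ} (hk : 2 ≤ k) {a : Fin k → ℤ} (ha : ∀ i, a i ≠ 0)
    (n : ℕ) (i : Fin k) (v : ℤ) :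
    ((boxSolutions a n).filter fun x => x i = v).card ≤ n ^ (k - 2) := by
  have : Nontrivial (Fin k) := Fin.nontrivial_iff_two_le.2 hk
  obtain ⟨l, hl⟩ := exists_ne i
  refine card_le_pow_of_determined hl
    (fun x hx => (mem_boxSolutions.1 (mem_filter.1 hx).1).1) fun x hx y hy h => ?_
  rw [mem_filter, mem_boxSolutions] at hx hy
  refine eq_of_sum_mul_eq ha hx.1.2 hy.1.2 l fun j hj => ?_
  by_cases hji : j = i
  · rw [hji, hx.2, hy.2]
  · exact h j hj hji

lemma card_boxSolutions_coord_eq_coord {k : ℕ} (hk : 3 ≤ k) {a : Fin k → ℤ} (ha : ∀ i, a i ≠ 0)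
    (n : ℕ) {i j : Fin k} (hij : i ≠ j) :
    ((boxSolutions a n).filter fun x => x i = x j).card ≤ n ^ (k - 2) := by
  obtain ⟨l, -, hl⟩ := exists_mem_notMem_of_card_lt_card (s := {i, j}) (t := univ)
    (by rw [card_pair hij]; simp; omega)
  simp only [mem_insert, mem_singleton, not_or] at hl
  refine card_le_pow_of_determined hl.2
    (fun x hx => (mem_boxSolutions.1 (mem_filter.1 hx).1).1) fun x hx y hy h => ?_
  rw [mem_filter, mem_boxSolutions] at hx hy
  refine eq_of_sum_mul_eq ha hx.1.2 hy.1.2 l fun t ht => ?_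
  by_cases htj : t = j
  · rw [htj, ← hx.2, ← hy.2]
    exact h i (Ne.symm hl.1) hij
  · exact h t ht htj

lemma card_boxSolutions_not_injective {k : ℕ} (hk : 3 ≤ k) {a : Fin k → ℤ} (ha : ∀ i, a i ≠ 0)
    (n : ℕ) :
    ((boxSolutions a n).filter fun x => ¬ Function.Injective x).card ≤ k ^ 2 * n ^ (k - 2) := by
  classical
  have hsub : ((boxSolutions a n).filter fun x => ¬ Function.Injective x) ⊆
      (univ : Finset (Fin k)).offDiag.biUnion
        fun q => (boxSolutions a n).filter fun x => x q.1 = x q.2 := by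
    intro x hx
    rw [mem_filter] at hx
    simp only [Function.Injective, not_forall] at hx
    obtain ⟨hx, i, j, h, hij⟩ := hx
    simp only [mem_biUnion, mem_offDiag, mem_filter]
    exact ⟨(i, j), ⟨mem_univ _, mem_univ _, hij⟩, hx, h⟩
  refine (card_le_card hsub).trans ((card_biUnion_le_card_mul _ _ (n ^ (k - 2))
    fun q hq => card_boxSolutions_coord_eq_coord hk ha n (mem_offDiag.1 hq).2.2).trans ?_)
  gcongr
  rw [offDiag_card, card_univ, Fintype.card_fin, sq]
  omega

/-- The number of solutions in a residue class changes little when the residue class is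
translated by an integer solution. -/
lemma card_boxSolutions_residue_le {k p : ℕ} (hk : 2 ≤ k) {a : Fin k → ℤ} (ha : ∀ i, a i ≠ 0)
    (v : Fin k → ℤ) (hv : ∑ i, a i * v i = 0) (n : ℕ) (y y' : Fin k → ZMod p)
    (hy : ∀ i, y' i = y i + v i) :
    ((boxSolutions a n).filter fun x => ∀ i, (x i : ZMod p) = y i).card ≤
      ((boxSolutions a n).filter fun x => ∀ i, (x i : ZMod p) = y' i).card +
        (∑ i, 2 * (v i).natAbs) * n ^ (k - 2) := by
  classical
  let Z : Fin k → Finset ℤ := fun i =>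
    Icc (1 : ℤ) (v i).natAbs ∪ Ioc (n - (v i).natAbs : ℤ) n
  let B : Finset (Fin k → ℤ) := univ.biUnion fun i : Fin k =>
    (Z i).biUnion fun z => (boxSolutions a n).filter fun x => x i = z
  have hZ : ∀ i, (Z i).card ≤ 2 * (v i).natAbs := fun i =>
    (card_union_le _ _).trans (by simp only [Int.card_Icc, Int.card_Ioc]; omega)
  have hB : B.card ≤ (∑ i, 2 * (v i).natAbs) * n ^ (k - 2) := by
    rw [sum_mul]
    refine card_biUnion_le.trans (sum_le_sum fun i _ => ?_)
    exact (card_biUnion_le_card_mul _ _ (n ^ (k - 2))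
      fun z _ => card_boxSolutions_coord_eq hk ha n i z).trans (Nat.mul_le_mul_right _ (hZ i))
  refine le_trans ?_ (Nat.add_le_add_left hB _)
  have hsub : ((boxSolutions a n).filter fun x => ∀ i, (x i : ZMod p) = y i) ⊆
      (((boxSolutions a n).filter fun x => ∀ i, (x i : ZMod p) = y' i).image (· - v)) ∪ B := by
    intro x hx
    rw [mem_filter, mem_boxSolutions] at hx
    obtain ⟨⟨hbox, hsol⟩, hres⟩ := hx
    rw [mem_union]
    by_cases h : ∀ i, 1 ≤ x i + v i ∧ x i + v i ≤ n
    · refine Or.inl (mem_image.2 ⟨x + v, ?_, by simp⟩)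
      rw [mem_filter, mem_boxSolutions]
      refine ⟨⟨h, ?_⟩, fun i => ?_⟩
      · simp [mul_add, sum_add_distrib, hsol, hv]
      · simp [hres, hy]
    · obtain ⟨i, hi⟩ := not_forall.1 h
      refine Or.inr (mem_biUnion.2 ⟨i, mem_univ i, mem_biUnion.2 ⟨x i, ?_, ?_⟩⟩)
      · have := hbox i
        simp only [Z, mem_union, mem_Icc, mem_Ioc]
        omega
      · exact mem_filter.2 ⟨mem_boxSolutions.2 ⟨hbox, hsol⟩, rfl⟩
  exact (card_le_card hsub).trans ((card_union_le _ _).trans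
    (Nat.add_le_add_right card_image_le _))

/-- Solutions modulo a prime not dividing some coefficient lift to integer solutions. -/
lemma exists_int_solution_lift {k p : ℕ} [Fact p.Prime] {a : Fin k → ℤ} (l : Fin k)
    (hl : (a l : ZMod p) ≠ 0) (w : Fin k → ZMod p) (hw : ∑ i, (a i : ZMod p) * w i = 0) :
    ∃ v : Fin k → ℤ, ∑ i, a i * v i = 0 ∧ ∀ i, (v i : ZMod p) = w i := by
  choose u hu using fun i => ZMod.intCast_surjective (w i * (a l : ZMod p)⁻¹)
  refine ⟨fun i => a l * u i - if i = l then ∑ j, a j * u j else 0, ?_, fun i => ?_⟩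
  · simp only [mul_sub, sum_sub_distrib, mul_ite, mul_zero, sum_ite_eq', mem_univ, if_true]
    rw [mul_sum, sub_eq_zero]
    exact sum_congr rfl fun i _ => by ring
  · have h0 : ((∑ j, a j * u j : ℤ) : ZMod p) = 0 := by
      push_cast
      simp only [hu, ← mul_assoc, ← sum_mul, hw, zero_mul]
    have : (((if i = l then ∑ j, a j * u j else 0 : ℤ)) : ZMod p) = 0 := by
      split_ifs
      · exact h0
      · simp
    rw [Int.cast_sub, this, sub_zero, Int.cast_mul, hu]
    field_simp

/-- The solutions of the equation modulo `p`. -/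
noncomputable def modSolutions {k : ℕ} (a : Fin k → ℤ) (p : ℕ) [NeZero p] :
    Finset (Fin k → ZMod p) :=
  univ.filter fun y => ∑ i, (a i : ZMod p) * y i = 0

lemma mem_modSolutions {k p : ℕ} [NeZero p] {a : Fin k → ℤ} {y : Fin k → ZMod p} :
    y ∈ modSolutions a p ↔ ∑ i, (a i : ZMod p) * y i = 0 := by
  simp [modSolutions]

/-- The integer solutions are almost equidistributed among the solutions modulo `p`. -/
lemma exists_card_boxSolutions_residue_le {k p : ℕ} [Fact p.Prime] (hk : 2 ≤ k) {a : Fin k → ℤ}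
    (ha : ∀ i, a i ≠ 0) (l : Fin k) (hl : (a l : ZMod p) ≠ 0) :
    ∃ C : ℕ, ∀ n : ℕ, ∀ y ∈ modSolutions a p, ∀ y' ∈ modSolutions a p,
      ((boxSolutions a n).filter fun x => ∀ i, (x i : ZMod p) = y i).card ≤
        ((boxSolutions a n).filter fun x => ∀ i, (x i : ZMod p) = y' i).card +
          C * n ^ (k - 2) := by
  have key : ∀ q : modSolutions a p × modSolutions a p, ∃ C : ℕ, ∀ n : ℕ,
      ((boxSolutions a n).filter fun x => ∀ i, (x i : ZMod p) = q.1.1 i).card ≤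
        ((boxSolutions a n).filter fun x => ∀ i, (x i : ZMod p) = q.2.1 i).card +
          C * n ^ (k - 2) := by
    rintro ⟨⟨y, hy⟩, ⟨y', hy'⟩⟩
    rw [mem_modSolutions] at hy hy'
    obtain ⟨v, hv, hvy⟩ := exists_int_solution_lift l hl (y' - y)
      (by simp [mul_sub, sum_sub_distrib, hy, hy'])
    exact ⟨_, fun n => card_boxSolutions_residue_le hk ha v hv n y y' fun i => by simp [hvy]⟩
  choose C hC using key
  refine ⟨∑ q, C q, fun n y hy y' hy' => (hC (⟨y, hy⟩, ⟨y', hy'⟩) n).trans ?_⟩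
  gcongr
  exact single_le_sum (f := C) (fun _ _ => Nat.zero_le _) (mem_univ _)

/-- Averaging a nonnegative function over the integer solutions is bounded by its average over the
solutions modulo `p`, up to a boundary term. -/
lemma exists_sum_boxSolutions_le {k p : ℕ} [Fact p.Prime] (hk : 2 ≤ k) {a : Fin k → ℤ}
    (ha : ∀ i, a i ≠ 0) (l : Fin k) (hl : (a l : ZMod p) ≠ 0) :
    ∃ C : ℕ, ∀ n : ℕ, ∀ φ : (Fin k → ZMod p) → ℝ, (∀ y, 0 ≤ φ y) →
      (modSolutions a p).card * ∑ x ∈ boxSolutions a n, φ (fun i => x i) ≤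
        (∑ y ∈ modSolutions a p, φ y) *
          ((boxSolutions a n).card + (modSolutions a p).card * (C * (n : ℝ) ^ (k - 2))) := by
  obtain ⟨C, hC⟩ := exists_card_boxSolutions_residue_le hk ha l hl
  refine ⟨C, fun n φ hφ => ?_⟩
  have hmaps : ∀ x ∈ boxSolutions a n, (fun i => (x i : ZMod p)) ∈ modSolutions a p := by
    intro x hx
    rw [mem_modSolutions]
    exact_mod_cast congrArg (Int.cast : ℤ → ZMod p) (mem_boxSolutions.1 hx).2
  set N : (Fin k → ZMod p) → ℕ := fun y =>
    ((boxSolutions a n).filter fun x => ∀ i, (x i : ZMod p) = y i).card with hN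
  have hsum : ∑ x ∈ boxSolutions a n, φ (fun i => x i) = ∑ y ∈ modSolutions a p, φ y * N y := by
    rw [← sum_fiberwise_of_maps_to hmaps]
    refine sum_congr rfl fun y _ => ?_
    rw [sum_congr rfl (g := fun _ => φ y) fun x hx => by rw [(mem_filter.1 hx).2], sum_const,
      nsmul_eq_mul, mul_comm]
    simp only [hN, funext_iff]
  have hcard : ((boxSolutions a n).card : ℝ) = ∑ y ∈ modSolutions a p, (N y : ℝ) := by
    rw [card_eq_sum_card_fiberwise hmaps]
    simp only [hN, funext_iff, Nat.cast_sum]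
  rw [hsum, hcard, mul_sum, sum_mul]
  refine sum_le_sum fun y hy => ?_
  have : ((modSolutions a p).card : ℝ) * N y ≤
      ∑ y ∈ modSolutions a p, (N y : ℝ) + (modSolutions a p).card * (C * (n : ℝ) ^ (k - 2)) := by
    rw [← nsmul_eq_mul, ← nsmul_eq_mul, ← sum_const, ← sum_const, ← sum_add_distrib]
    exact sum_le_sum fun y' hy' => by exact_mod_cast hC n y hy y' hy'
  calc ((modSolutions a p).card : ℝ) * (φ y * N y)
      = φ y * ((modSolutions a p).card * N y) := by ring
    _ ≤ _ := mul_le_mul_of_nonneg_left this (hφ y)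

/-- If `φ` does not depend on a coordinate whose coefficient is invertible, then its sum over the
solutions modulo `p` is the expected proportion of its total sum. -/
lemma mul_sum_modSolutions {k p : ℕ} [Fact p.Prime] {a : Fin k → ℤ} (l : Fin k)
    (hl : (a l : ZMod p) ≠ 0) (φ : (Fin k → ZMod p) → ℝ)
    (hφ : ∀ y z, φ (Function.update y l z) = φ y) :
    (p : ℝ) * ∑ y ∈ modSolutions a p, φ y = ∑ y, φ y := by
  have hfib : ∀ s : ZMod p, ∑ y ∈ univ.filter (fun y : Fin k → ZMod p =>
      ∑ i, (a i : ZMod p) * y i = s), φ y = ∑ y ∈ modSolutions a p, φ y := by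
    intro s
    simp only [modSolutions, sum_filter]
    refine (Fintype.sum_equiv (Equiv.addRight (Pi.single l ((a l : ZMod p)⁻¹ * s))) _ _ ?_).symm
    intro y
    have h1 : φ (y + Pi.single l ((a l : ZMod p)⁻¹ * s)) = φ y := by
      rw [← hφ y (y l + (a l : ZMod p)⁻¹ * s)]
      congr 1
      ext i
      by_cases hi : i = l
      · subst hi; simp
      · simp [hi]
    have h2 : ∑ i, (a i : ZMod p) * (y + (Pi.single l ((a l : ZMod p)⁻¹ * s) : Fin k → ZMod p)) i =
        ∑ i, (a i : ZMod p) * y i + s := by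
      simp only [Pi.add_apply, mul_add, sum_add_distrib, add_right_inj]
      rw [Fintype.sum_eq_single l fun i hi => by rw [Pi.single_eq_of_ne hi, mul_zero],
        Pi.single_eq_same, mul_inv_cancel_left₀ hl]
    simp only [Equiv.coe_addRight, h1, h2, add_eq_right]
  rw [← sum_fiberwise univ (fun y : Fin k → ZMod p => ∑ i, (a i : ZMod p) * y i) φ]
  simp [hfib, ZMod.card]

lemma card_modSolutions {k p : ℕ} [Fact p.Prime] {a : Fin k → ℤ} (l : Fin k)
    (hl : (a l : ZMod p) ≠ 0) : (p : ℝ) * (modSolutions a p).card = (p : ℝ) ^ k := by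
  simpa [ZMod.card] using mul_sum_modSolutions l hl (fun _ => 1) (fun _ _ => rfl)

/-- The perturbation `1 + t (1₀ - 1/p)` of the constant weight on `ZMod p`. -/
noncomputable def perturbedWeight (p : ℕ) (t : ℝ) (z : ZMod p) : ℝ :=
  1 - t / p + if z = 0 then t else 0

lemma mul_sum_modSolutions_prod_perturbedWeight {k p : ℕ} [Fact p.Prime] {a : Fin k → ℤ}
    (hl : ∀ l, (a l : ZMod p) ≠ 0) (t : ℝ) :
    (p : ℝ) * ∑ y ∈ modSolutions a p, ∏ i, perturbedWeight p t (y i) =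
      (p : ℝ) ^ k + t ^ k * (p - 1) := by
  classical
  have hp : (p : ℝ) ≠ 0 := by exact_mod_cast (Fact.out : p.Prime).ne_zero
  have hexp : ∀ y : Fin k → ZMod p, ∏ i, perturbedWeight p t (y i) =
      ∑ s ∈ (univ : Finset (Fin k)).powerset,
        (1 - t / p) ^ (univ \ s).card * ∏ i ∈ s, if y i = 0 then t else 0 := by
    intro y
    simp only [perturbedWeight, add_comm (1 - t / p)]
    rw [prod_add]
    exact sum_congr rfl fun s _ => by rw [prod_const, mul_comm]
  have hdelta : ∀ y : Fin k → ZMod p, (∏ i, if y i = 0 then t else 0) =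
      if y = 0 then t ^ k else 0 := by
    intro y
    rw [prod_ite_zero]
    simp [funext_iff]
  have hall : ∑ y : Fin k → ZMod p, ∏ i, perturbedWeight p t (y i) = (p : ℝ) ^ k := by
    rw [← Fintype.piFinset_univ, ← prod_univ_sum]
    have : ∑ z : ZMod p, perturbedWeight p t z = p := by
      simp only [perturbedWeight, sum_add_distrib, sum_const, card_univ, ZMod.card, sum_ite_eq',
        mem_univ, if_true, nsmul_eq_mul]
      field_simp
      ring
    simp [this]
  rw [← hall]
  simp only [hexp]
  rw [sum_comm, sum_comm (s := univ), mul_sum, ← sum_erase_add _ _ (mem_powerset_self univ),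
    ← sum_erase_add _ _ (mem_powerset_self univ), add_assoc]
  congr 1
  · refine sum_congr rfl fun s hs => ?_
    obtain ⟨l, hls⟩ : ∃ l, l ∉ s := by
      by_contra! h
      exact ne_of_mem_erase hs (eq_univ_iff_forall.2 h)
    refine mul_sum_modSolutions l (hl l) _ fun y z => ?_
    congr 1
    refine prod_congr rfl fun i hi => ?_
    rw [Function.update_of_ne (ne_of_mem_of_not_mem hi hls)]
  · simp only [sdiff_self, hdelta]
    simp [mem_modSolutions]
    ring

/-- Independently rounding a fractional coloring `f`: some coloring has at most the expected
number of monochromatic tuples. -/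
lemma exists_coloring_card_monochromatic_le {σ ι κ J : Type*} [Fintype ι] [Fintype κ]
    [Nonempty κ] [Fintype J] [DecidableEq J] (S : Finset σ) (X : σ → κ → ι)
    (hX : ∀ s ∈ S, Function.Injective (X s)) (f : ι → J → ℝ) (hf : ∀ z j, 0 ≤ f z j)
    (hf1 : ∀ z, ∑ j, f z j = 1) :
    ∃ c : ι → J, ((S.filter fun s => ∀ i i', c (X s i) = c (X s i')).card : ℝ) ≤
      ∑ s ∈ S, ∑ j, ∏ i, f (X s i) j := by
  classical
  have hprob : ∑ c : ι → J, ∏ z, f z (c z) = 1 := by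
    rw [← Fintype.piFinset_univ, ← prod_univ_sum]
    simp [hf1]
  have hcolor : ∀ s ∈ S, ∀ j : J,
      ∑ c : ι → J, (∏ z, f z (c z)) * (if ∀ i, c (X s i) = j then 1 else 0) =
        ∏ i, f (X s i) j := by
    intro s hs j
    have hsplit : ∀ c : ι → J, (∏ z, f z (c z)) * (if ∀ i, c (X s i) = j then 1 else 0) =
        ∏ z, if z ∈ univ.image (X s) → c z = j then f z (c z) else 0 := by
      intro c
      rw [prod_ite_zero, mul_ite, mul_one, mul_zero]
      congr 1
      simp
    simp only [hsplit]
    rw [← Fintype.piFinset_univ,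
      ← prod_univ_sum (fun _ => univ) fun z c => if z ∈ univ.image (X s) → c = j then f z c else 0,
      ← prod_image (s := univ) (g := X s) (f := fun z => f z j) ((hX s hs).injOn),
      ← prod_subset (subset_univ (univ.image (X s)))]
    · refine prod_congr rfl fun z hz => ?_
      simp [hz]
    · intro z _ hz
      simp [hz, hf1]
  have hmono : ∀ (c : ι → J) (s : σ), (if ∀ i i', c (X s i) = c (X s i') then (1 : ℝ) else 0) =
      ∑ j, if ∀ i, c (X s i) = j then (1 : ℝ) else 0 := by
    intro c s
    obtain ⟨i₀⟩ := ‹Nonempty κ›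
    rw [Fintype.sum_eq_single (c (X s i₀)) fun j hj => if_neg fun h => hj (h i₀).symm]
    congr 1
    exact propext ⟨fun h i => h i i₀, fun h i i' => (h i).trans (h i').symm⟩
  have hexpect : ∑ c : ι → J, (∏ z, f z (c z)) *
      ((S.filter fun s => ∀ i i', c (X s i) = c (X s i')).card : ℝ) =
        ∑ s ∈ S, ∑ j, ∏ i, f (X s i) j := by
    simp only [card_filter, Nat.cast_sum, Nat.cast_ite, Nat.cast_one, Nat.cast_zero, hmono,
      mul_sum]
    rw [sum_comm]
    refine sum_congr rfl fun s hs => ?_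
    rw [sum_comm]
    exact sum_congr rfl fun j _ => hcolor s hs j
  by_contra! h
  have hnonneg : ∀ c : ι → J, 0 ≤ ∏ z, f z (c z) := fun c => prod_nonneg fun z _ => hf z _
  obtain ⟨c₀, hc₀⟩ : ∃ c : ι → J, 0 < ∏ z, f z (c z) := by
    by_contra! h0
    have := sum_nonpos fun c (_ : c ∈ univ) => h0 c
    linarith
  refine lt_irrefl (∑ s ∈ S, ∑ j, ∏ i, f (X s i) j) ?_
  calc ∑ s ∈ S, ∑ j, ∏ i, f (X s i) j
      = ∑ c : ι → J, (∏ z, f z (c z)) * ∑ s ∈ S, ∑ j, ∏ i, f (X s i) j := by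
        rw [← sum_mul, hprob, one_mul]
    _ < _ := sum_lt_sum (fun c _ => mul_le_mul_of_nonneg_left (h c).le (hnonneg c))
        ⟨c₀, mem_univ _, mul_lt_mul_of_pos_left (h c₀) hc₀⟩
    _ = _ := hexpect

/-- An equation with coefficients of both signs has a positive integer solution. -/
lemma exists_pos_solution {k : ℕ} {a : Fin k → ℤ} {i j : Fin k} (hi : 0 < a i) (hj : a j < 0) :
    ∃ w : Fin k → ℤ, (∀ t, 1 ≤ w t ∧ w t ≤ ∑ s, |a s|) ∧ ∑ t, a t * w t = 0 := by
  have hneg : 1 ≤ ∑ s, (a s)⁻ := by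
    have := single_le_sum (f := fun s => (a s)⁻) (fun s _ => negPart_nonneg _) (mem_univ j)
    simp only [negPart_of_nonpos hj.le] at this
    omega
  have hpos : 1 ≤ ∑ s, (a s)⁺ := by
    have := single_le_sum (f := fun s => (a s)⁺) (fun s _ => posPart_nonneg _) (mem_univ i)
    simp only [posPart_of_nonneg hi.le] at this
    omega
  have hadd : ∑ s, |a s| = ∑ s, (a s)⁺ + ∑ s, (a s)⁻ := by
    rw [← sum_add_distrib]
    exact sum_congr rfl fun s _ => (posPart_add_negPart _).symm
  refine ⟨fun t => if 0 ≤ a t then ∑ s, (a s)⁻ else ∑ s, (a s)⁺, fun t => ?_, ?_⟩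
  · dsimp only
    split_ifs <;> omega
  · have : ∀ t, a t * (if 0 ≤ a t then ∑ s, (a s)⁻ else ∑ s, (a s)⁺) =
        (a t)⁺ * ∑ s, (a s)⁻ - (a t)⁻ * ∑ s, (a s)⁺ := by
      intro t
      split_ifs with h
      · rw [posPart_of_nonneg h, negPart_of_nonneg h]
        ring
      · rw [posPart_of_nonpos (by omega), negPart_of_nonpos (by omega)]
        ring
    simp only [this, sum_sub_distrib, ← sum_mul]
    ring

/-- An equation with coefficients of both signs has `Ω(n ^ (k - 1))` solutions in the box. -/
lemma exists_le_card_boxSolutions {k : ℕ} {a : Fin k → ℤ} (ha : ∀ i, a i ≠ 0) {i j : Fin k}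
    (hi : 0 < a i) (hj : a j < 0) :
    ∃ c : ℝ, 0 < c ∧ ∃ N₀ : ℕ, ∀ n : ℕ, N₀ ≤ n →
      c * (n : ℝ) ^ (k - 1) ≤ (boxSolutions a n).card := by
  classical
  obtain ⟨w, hw, hsol⟩ := exists_pos_solution hi hj
  obtain ⟨A, hA⟩ := Int.eq_ofNat_of_zero_le (sum_nonneg fun s (_ : s ∈ univ) => abs_nonneg (a s))
  simp only [hA] at hw
  have hA1 : 1 ≤ A := by have := hw i; omega
  have hle : ∀ t, |a t| ≤ A := fun t =>
    hA ▸ single_le_sum (f := fun s => |a s|) (fun s _ => abs_nonneg _) (mem_univ t)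
  set B := A ^ 2 + 2 * A with hB
  have hBpos : 0 < B := by positivity
  refine ⟨(1 / (2 * B)) ^ (k - 1), by positivity, B, fun n hn => ?_⟩
  set L := n / B with hL
  have hL1 : 1 ≤ L := (Nat.one_le_div_iff hBpos).2 hn
  have hLn : B * L ≤ n := Nat.mul_div_le n B
  let P : Finset (Fin k → ℤ) :=
    Fintype.piFinset fun t => if t = i then {0} else Icc (1 : ℤ) L
  have hP : P.card = L ^ (k - 1) := by
    rw [Fintype.card_piFinset, ← mul_prod_erase _ _ (mem_univ i),
      prod_congr rfl (g := fun _ => L) fun t ht => by simp [ne_of_mem_erase ht]]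
    simp
  have hPmem : ∀ s ∈ P, s i = 0 ∧ ∀ t, |s t| ≤ L := by
    intro s hs
    rw [Fintype.mem_piFinset] at hs
    have h0 : s i = 0 := by simpa using hs i
    refine ⟨h0, fun t => ?_⟩
    by_cases ht : t = i
    · rw [ht, h0]; simp
    · have := hs t
      rw [if_neg ht, mem_Icc] at this
      rw [abs_le]
      omega
  let F : (Fin k → ℤ) → Fin k → ℤ := fun s t =>
    (A + 1) * L * w t + (a i * s t - if t = i then ∑ q, a q * s q else 0)
  have hcard : P.card ≤ (boxSolutions a n).card := by
    refine card_le_card_of_injOn F (fun s hs => ?_) fun s hs s' hs' h => ?_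
    · obtain ⟨h0, hsL⟩ := hPmem s hs
      refine mem_coe.2 (mem_boxSolutions.2 ⟨fun t => ?_, ?_⟩)
      · have hdev : |a i * s t - if t = i then ∑ q, a q * s q else 0| ≤ A * L := by
          by_cases ht : t = i
          · rw [if_pos ht, ht, h0, mul_zero, zero_sub, abs_neg, ← Int.natCast_mul, Nat.cast_mul]
            rw [show (A : ℤ) = ∑ s, |a s| from hA.symm, sum_mul]
            refine (abs_sum_le_sum_abs _ _).trans (sum_le_sum fun q _ => ?_)
            rw [abs_mul]
            exact mul_le_mul_of_nonneg_left (hsL q) (abs_nonneg _)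
          · rw [if_neg ht, sub_zero, abs_mul]
            exact mul_le_mul (hle i) (hsL t) (abs_nonneg _) (by positivity)
        rw [abs_le] at hdev
        have hlow : ((A + 1) * L : ℤ) * 1 ≤ (A + 1) * L * w t :=
          mul_le_mul_of_nonneg_left (hw t).1 (by positivity)
        have hupp : ((A + 1) * L : ℤ) * w t ≤ (A + 1) * L * A :=
          mul_le_mul_of_nonneg_left (hw t).2 (by positivity)
        have hLn' : ((A : ℤ) ^ 2 + 2 * A) * L ≤ n := by exact_mod_cast hLn
        have hL1' : (1 : ℤ) ≤ L := by exact_mod_cast hL1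
        constructor <;> simp only [F] <;> nlinarith
      · simp only [F, mul_add, mul_sub, sum_add_distrib, sum_sub_distrib, mul_ite, mul_zero,
          sum_ite_eq', mem_univ, if_true, mul_left_comm _ ((A + 1) * L : ℤ), ← mul_sum, hsol,
          mul_left_comm _ (a i)]
        ring
    · funext t
      by_cases ht : t = i
      · rw [ht, (hPmem s hs).1, (hPmem s' hs').1]
      · have := congrFun h t
        simp only [F, if_neg ht, sub_zero, add_right_inj] at this
        exact mul_left_cancel₀ (ha i) this
  have hnL : (1 / (2 * B) : ℝ) * n ≤ L := by
    have h : n < 2 * B * L := by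
      have := Nat.lt_mul_div_succ n hBpos
      rw [← hL] at this
      nlinarith
    rw [one_div, inv_mul_le_iff₀ (by positivity)]
    exact_mod_cast h.le
  rw [← mul_pow]
  calc ((1 / (2 * B) : ℝ) * n) ^ (k - 1) ≤ (L : ℝ) ^ (k - 1) := by gcongr
    _ ≤ _ := by exact_mod_cast hP ▸ hcard

lemma perturbedWeight_nonneg {p : ℕ} (hp : 1 ≤ p) {t : ℝ} (ht : -1 ≤ t) (ht' : t ≤ 1)
    (z : ZMod p) : 0 ≤ perturbedWeight p t z := by
  have hp' : (1 : ℝ) ≤ p := by exact_mod_cast hp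
  have h1 : t / p ≤ 1 := (div_le_one (by linarith)).2 (by linarith)
  have h2 : 0 ≤ 1 - t / p + t := by
    have : 1 - t / p + t = (p + t * (p - 1)) / p := by field_simp; ring
    rw [this]
    exact div_nonneg (by nlinarith) (by linarith)
  unfold perturbedWeight
  split_ifs
  · exact h2
  · linarith

lemma exists_sum_eq_zero_sum_pow_neg {k r : ℕ} (hk : Odd k) (hk3 : 3 ≤ k) (hr : 3 ≤ r) :
    ∃ t : Fin r → ℝ, (∀ j, -1 ≤ t j ∧ t j ≤ 1) ∧ ∑ j, t j = 0 ∧ ∑ j, t j ^ k < 0 := by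
  obtain ⟨s, rfl⟩ := Nat.exists_eq_add_of_le' hr
  refine ⟨Fin.cons (1 / 2) (Fin.cons (1 / 2) (Fin.cons (-1) fun _ => 0)), fun j => ?_, ?_, ?_⟩
  · refine Fin.cases ?_ (Fin.cases ?_ (Fin.cases ?_ fun _ => ?_)) j <;> norm_num [Fin.cons]
  · simp [Fin.sum_univ_succ]
    norm_num
  · have h8 : (2⁻¹ : ℝ) ^ k ≤ 2⁻¹ ^ 3 := pow_le_pow_of_le_one (by norm_num) (by norm_num) hk3
    simp [Fin.sum_univ_succ, hk.neg_one_pow, show k ≠ 0 by omega] at h8 ⊢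
    norm_num at h8 ⊢
    linarith

/-- A fractional coloring of the residues modulo `p` with fewer monochromatic solutions modulo `p`
than the constant one. -/
lemma exists_fractional_coloring {k r p : ℕ} [Fact p.Prime] (hk : Odd k) (hk3 : 3 ≤ k)
    (hr : 3 ≤ r) {a : Fin k → ℤ} (hl : ∀ l, (a l : ZMod p) ≠ 0) :
    ∃ f : ZMod p → Fin r → ℝ, (∀ z j, 0 ≤ f z j) ∧ (∀ z, ∑ j, f z j = 1) ∧
      (r : ℝ) ^ (k - 1) * ∑ y ∈ modSolutions a p, ∑ j, ∏ i, f (y i) j <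
        (modSolutions a p).card := by
  obtain ⟨t, ht, ht0, htk⟩ := exists_sum_eq_zero_sum_pow_neg hk hk3 hr
  have hp2 := (Fact.out : p.Prime).two_le
  have hp : (2 : ℝ) ≤ p := by exact_mod_cast hp2
  have hr0 : (0 : ℝ) < r := by exact_mod_cast (by omega : 0 < r)
  refine ⟨fun z j => perturbedWeight p (t j) z / r, fun z j =>
    div_nonneg (perturbedWeight_nonneg (by omega) (ht j).1 (ht j).2 z) hr0.le, fun z => ?_, ?_⟩
  · have : ∑ j, perturbedWeight p (t j) z = r := by
      unfold perturbedWeight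
      split_ifs <;> simp [sum_add_distrib, sum_sub_distrib, ← sum_div, ht0]
    rw [← sum_div, this, div_self hr0.ne']
  · refine lt_of_mul_lt_mul_left ?_ (by linarith : (0 : ℝ) ≤ p)
    have hpow : (r : ℝ) ^ k = r ^ (k - 1) * r := by
      rw [← pow_succ, Nat.sub_add_cancel (by omega)]
    have hsum : (p : ℝ) * ((r : ℝ) ^ (k - 1) *
        ∑ y ∈ modSolutions a p, ∑ j, ∏ i, perturbedWeight p (t j) (y i) / r) =
          (∑ j, ((p : ℝ) ^ k + t j ^ k * (p - 1))) / r := by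
      simp only [← mul_sum_modSolutions_prod_perturbedWeight hl, prod_div_distrib, prod_const,
        card_univ, Fintype.card_fin, ← sum_div, ← mul_sum]
      rw [sum_comm, hpow]
      field_simp
    rw [hsum, card_modSolutions ⟨0, by omega⟩ (hl _), sum_add_distrib, ← sum_mul,
      div_lt_iff₀ hr0]
    simp only [sum_const, card_univ, Fintype.card_fin, nsmul_eq_mul]
    nlinarith

/-- A coloring of the integers obtained by rounding a fractional coloring of the residues. -/
lemma exists_coloring_card_boxSolutions_le {k r p : ℕ} (hk : 3 ≤ k) {a : Fin k → ℤ}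
    (ha : ∀ i, a i ≠ 0) (f : ZMod p → Fin r → ℝ) (hf : ∀ z j, 0 ≤ f z j)
    (hf1 : ∀ z, ∑ j, f z j = 1) (n : ℕ) :
    ∃ c : ℤ → Fin r,
      (((boxSolutions a n).filter fun x => ∀ i j, c (x i) = c (x j)).card : ℝ) ≤
        k ^ 2 * (n : ℝ) ^ (k - 2) + ∑ x ∈ boxSolutions a n, ∑ j, ∏ i, f (x i) j := by
  classical
  have : Nonempty (Fin k) := ⟨⟨0, by omega⟩⟩
  have hval : ∀ z : ℤ, 1 ≤ z → z ≤ n → ((z : ZMod (n + 1)).val : ℤ) = z := by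
    intro z h1 h2
    rw [ZMod.val_intCast]
    exact Int.emod_eq_of_lt (by omega) (by push_cast; omega)
  set I := (boxSolutions a n).filter fun x => Function.Injective x with hI
  have hbox : ∀ x ∈ I, ∀ i, ((x i : ZMod (n + 1)).val : ℤ) = x i := fun x hx i => by
    have := (mem_boxSolutions.1 (mem_filter.1 hx).1).1 i
    exact hval _ this.1 this.2
  obtain ⟨c, hc⟩ := exists_coloring_card_monochromatic_le I
    (fun x i => (x i : ZMod (n + 1)))
    (fun x hx i j hij => (mem_filter.1 hx).2 (by
      rw [← hbox x hx i, ← hbox x hx j]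
      exact congrArg (fun z : ZMod (n + 1) => (z.val : ℤ)) hij))
    (fun z => f (z.val : ℤ)) (fun z j => hf _ j) (fun z => hf1 _)
  refine ⟨fun z => c z, ?_⟩
  replace hc : ((I.filter fun x => ∀ i j, c (x i) = c (x j)).card : ℝ) ≤
      ∑ x ∈ I, ∑ j, ∏ i, f (x i) j := by
    rw [sum_congr rfl (g := fun x => ∑ j, ∏ i, f (x i) j) fun x hx => by
      simp only [hbox x hx]] at hc
    convert hc
  have hsub : ((boxSolutions a n).filter fun x => ∀ i j, c (x i) = c (x j)) ⊆
      ((boxSolutions a n).filter fun x => ¬ Function.Injective x) ∪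
        I.filter fun x => ∀ i j, c (x i) = c (x j) := by
    intro x hx
    rw [mem_filter] at hx
    by_cases h : Function.Injective x <;> simp [hI, hx.1, h]
    exact hx.2
  have hcard : (((boxSolutions a n).filter fun x => ∀ i j, c (x i) = c (x j)).card : ℝ) ≤
      k ^ 2 * (n : ℝ) ^ (k - 2) + (I.filter fun x => ∀ i j, c (x i) = c (x j)).card := by
    exact_mod_cast (card_le_card hsub).trans ((card_union_le _ _).trans
      (Nat.add_le_add_right (card_boxSolutions_not_injective hk ha n) _))
  refine hcard.trans ((add_le_add_iff_left _).2 (hc.trans ?_))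
  exact sum_le_sum_of_subset_of_nonneg (filter_subset _ _)
    fun x _ _ => sum_nonneg fun j _ => prod_nonneg fun i _ => hf _ j

lemma exists_prime_forall_coeff_ne_zero {k : ℕ} {a : Fin k → ℤ} (ha : ∀ i, a i ≠ 0) :
    ∃ p : ℕ, p.Prime ∧ ∀ i, (a i : ZMod p) ≠ 0 := by
  obtain ⟨p, hp, hprime⟩ := Nat.exists_infinite_primes (∑ i, (a i).natAbs + 1)
  refine ⟨p, hprime, fun i h => ?_⟩
  rw [ZMod.intCast_zmod_eq_zero_iff_dvd, Int.natCast_dvd] at h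
  have h1 := Nat.le_of_dvd (Int.natAbs_pos.2 (ha i)) h
  have h2 := single_le_sum (f := fun i => (a i).natAbs) (fun _ _ => Nat.zero_le _) (mem_univ i)
  omega

/-- Equations whose coefficients do not take both signs have no positive solutions. -/
lemma boxSolutions_eq_empty {k : ℕ} (hk : 0 < k) {a : Fin k → ℤ} (ha : ∀ i, a i ≠ 0)
    (h : ¬ ((∃ i, 0 < a i) ∧ ∃ j, a j < 0)) (n : ℕ) : boxSolutions a n = ∅ := by
  have : Nonempty (Fin k) := ⟨⟨0, hk⟩⟩
  refine eq_empty_of_forall_notMem fun x hx => ?_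
  obtain ⟨hbox, hsol⟩ := mem_boxSolutions.1 hx
  rw [not_and_or, not_exists, not_exists] at h
  rcases h with h | h
  · have := sum_neg (s := univ) (f := fun i => a i * x i) (fun i _ =>
      mul_neg_of_neg_of_pos (lt_of_le_of_ne (not_lt.1 (h i)) (ha i)) (hbox i).1) univ_nonempty
    exact this.ne hsol
  · have := sum_pos (s := univ) (f := fun i => a i * x i) (fun i _ =>
      mul_pos (lt_of_le_of_ne (not_lt.1 (h i)) (ha i).symm) (hbox i).1) univ_nonempty
    exact this.ne' hsol

/-- Every linear equation with an odd number of terms `k = 2m+1` and nonzero integer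
coefficients is `r`-uncommon over the integers for every `r ≥ 3`. -/
theorem odd_equation_r_uncommon_over_integers
    (m : ℕ) (hm : 1 ≤ m) (k : ℕ) (hk : k = 2 * m + 1)
    (a : Fin k → ℤ) (ha : ∀ i, a i ≠ 0)
    (r : ℕ) (hr : 3 ≤ r) :
    ∃ δ : ℝ, 0 < δ ∧ ∃ N₀ : ℕ, ∀ n : ℕ, N₀ ≤ n →
      ∃ c : ℤ → Fin r,
        (r : ℝ) ^ (k - 1) *
          (((Fintype.piFinset fun _ : Fin k => Finset.Icc (1 : ℤ) n).filter
            (fun x => ∑ i, a i * x i = 0 ∧ ∀ i j, c (x i) = c (x j))).card : ℝ)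
        ≤ (1 - δ) *
          (((Fintype.piFinset fun _ : Fin k => Finset.Icc (1 : ℤ) n).filter
            (fun x => ∑ i, a i * x i = 0)).card : ℝ) := by
  simp only [← filter_filter]
  change ∃ δ : ℝ, 0 < δ ∧ ∃ N₀ : ℕ, ∀ n : ℕ, N₀ ≤ n → ∃ c : ℤ → Fin r,
    (r : ℝ) ^ (k - 1) * (((boxSolutions a n).filter fun x => ∀ i j, c (x i) = c (x j)).card : ℝ) ≤
      (1 - δ) * ((boxSolutions a n).card : ℝ)
  by_cases hsign : (∃ i, 0 < a i) ∧ ∃ j, a j < 0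
  swap
  · exact ⟨1, one_pos, 0, fun n _ => ⟨fun _ => ⟨0, by omega⟩, by
      simp [boxSolutions_eq_empty (by omega) ha hsign n]⟩⟩
  obtain ⟨⟨i, hi⟩, ⟨j, hj⟩⟩ := hsign
  have hk3 : 3 ≤ k := by omega
  obtain ⟨p, hprime, hp⟩ := exists_prime_forall_coeff_ne_zero ha
  have : Fact p.Prime := ⟨hprime⟩
  obtain ⟨f, hf, hf1, hlt⟩ := exists_fractional_coloring ⟨m, hk⟩ hk3 hr hp
  obtain ⟨C, hC⟩ := exists_sum_boxSolutions_le (by omega) ha i (hp i)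
  obtain ⟨c₀, hc₀, N₁, hN₁⟩ := exists_le_card_boxSolutions ha hi hj
  set M : ℝ := ((modSolutions a p).card : ℝ) with hM
  set R : ℝ := (r : ℝ) ^ (k - 1) with hR
  set Φ : ℝ := ∑ y ∈ modSolutions a p, ∑ j, ∏ i, f (y i) j with hΦ
  have hR0 : 0 ≤ R := by positivity
  have hΦ0 : 0 ≤ Φ := sum_nonneg fun y _ => sum_nonneg fun j _ => prod_nonneg fun i _ => hf _ j
  have hM0 : 0 < M := (mul_nonneg hR0 hΦ0).trans_lt hlt
  set δ : ℝ := (M - R * Φ) / (2 * M) with hδ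
  have hδ0 : 0 < δ := div_pos (by linarith) (by linarith)
  have hRΦ : R * Φ = M * (1 - 2 * δ) := by
    rw [hδ]
    field_simp
    ring
  set K : ℝ := R * k ^ 2 + M * C with hK
  refine ⟨δ, hδ0, max N₁ ⌈K / (δ * c₀)⌉₊, fun n hn => ?_⟩
  obtain ⟨c, hc⟩ := exists_coloring_card_boxSolutions_le hk3 ha f hf hf1 n
  refine ⟨c, (mul_le_mul_of_nonneg_left hc hR0).trans ?_⟩
  set S : ℝ := ((boxSolutions a n).card : ℝ) with hS
  set E : ℝ := ∑ x ∈ boxSolutions a n, ∑ j, ∏ i, f (x i) j with hE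
  set q : ℝ := (n : ℝ) ^ (k - 2) with hq
  have hq0 : 0 ≤ q := by positivity
  have hCn : M * E ≤ Φ * (S + M * (C * q)) :=
    hC n (fun y => ∑ j, ∏ i, f (y i) j) fun y =>
      sum_nonneg fun j _ => prod_nonneg fun i _ => hf _ j
  have hRE : R * E ≤ (1 - 2 * δ) * (S + M * (C * q)) := by
    refine le_of_mul_le_mul_left ?_ hM0
    calc M * (R * E) = R * (M * E) := by ring
      _ ≤ R * (Φ * (S + M * (C * q))) := mul_le_mul_of_nonneg_left hCn hR0
      _ = R * Φ * (S + M * (C * q)) := by ring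
      _ = _ := by rw [hRΦ]; ring
  have hMC : 0 ≤ δ * (M * (C * q)) :=
    mul_nonneg hδ0.le (mul_nonneg hM0.le (mul_nonneg C.cast_nonneg hq0))
  have hKq : K * q ≤ δ * S := by
    have h1 : K ≤ n * (δ * c₀) := by
      rw [← div_le_iff₀ (mul_pos hδ0 hc₀)]
      exact (Nat.le_ceil _).trans (Nat.cast_le.2 ((le_max_right _ _).trans hn))
    calc K * q ≤ n * (δ * c₀) * q := mul_le_mul_of_nonneg_right h1 hq0
      _ = δ * (c₀ * (n : ℝ) ^ (k - 1)) := by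
        rw [show k - 1 = k - 2 + 1 by omega, pow_succ]
        ring
      _ ≤ δ * S := mul_le_mul_of_nonneg_left (hN₁ n ((le_max_left _ _).trans hn)) hδ0.le
  rw [hK] at hKq
  linarith
end

section
/- Let m ≥ 1, k = 2m+1, let a_1, …, a_k be nonzero integers, let r ≥ 2, and let ℓ ≥ 2 be a positive integer coprime to every a_i. Let μ be the minimum over all colorings c : ℤ/ℓℤ → {1,…,r} of the quantity #{(x_1,…,x_k) ∈ (ℤ/ℓℤ)^k : a_1x_1 + ⋯ + a_kx_k = 0 and c(x_1) = ⋯ = c(x_k)} / ℓ^{k−1}. Then for every ε > 0 there exists N₀ such that for every n ≥ N₀ there is a coloring c : {1,…,n} → {1,…,r} with #{(x_1,…,x_k) ∈ {1,…,n}^k : a_1x_1 + ⋯ + a_kx_k = 0 and c(x_1) = ⋯ = c(x_k)} ≤ (μ + ε) · #{(x_1,…,x_k) ∈ {1,…,n}^k : a_1x_1 + ⋯ + a_kx_k = 0}. (Equivalently, limsup_{n→∞} μ_E({1,…,n}) ≤ μ_E(ℤ/ℓℤ).) -/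
open Finset in
/-- The solutions of `∑ i, a i * x i = 0` in a box inject into the product of the sides other than
that of a coordinate with nonzero coefficient. -/
theorem card_solutions_piFinset_le {ι : Type*} [Fintype ι] [DecidableEq ι] (a : ι → ℤ) (j : ι)
    (hj : a j ≠ 0) (F : ι → Finset ℤ) :
    ((Fintype.piFinset F).filter (fun x => ∑ i, a i * x i = 0)).card
      ≤ ∏ i ∈ univ.erase j, (F i).card := by
  have hcard : (Fintype.piFinset (Function.update F j {0})).card
      = ∏ i ∈ univ.erase j, (F i).card := by
    rw [Fintype.card_piFinset, ← mul_prod_erase univ _ (mem_univ j)]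
    simp only [Function.update_self, card_singleton, one_mul]
    refine prod_congr rfl fun i hi => ?_
    rw [Function.update_of_ne (ne_of_mem_erase hi)]
  rw [← hcard]
  refine card_le_card_of_injOn (fun x => Function.update x j 0) ?_ ?_
  · intro x hx
    have hx := (mem_filter.1 (mem_coe.1 hx)).1
    rw [Fintype.mem_piFinset] at hx
    refine mem_coe.2 (Fintype.mem_piFinset.2 fun i => ?_)
    rcases eq_or_ne i j with rfl | h
    · simp
    · simpa [Function.update_of_ne h] using hx i
  · intro x hx y hy hxy
    have hx := (mem_filter.1 (mem_coe.1 hx)).2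
    have hy := (mem_filter.1 (mem_coe.1 hy)).2
    have hne : ∀ i, i ≠ j → x i = y i := fun i hi => by
      simpa [Function.update_of_ne hi] using congrFun hxy i
    have hsum : ∑ i ∈ univ.erase j, a i * x i = ∑ i ∈ univ.erase j, a i * y i :=
      sum_congr rfl fun i hi => by rw [hne i (ne_of_mem_erase hi)]
    rw [← add_sum_erase univ _ (mem_univ j)] at hx hy
    funext i
    rcases eq_or_ne i j with rfl | h
    · exact mul_left_cancel₀ hj (by linarith)
    · exact hne i h

open Finset in
/-- Few solutions in `{1, …, n}` have a coordinate within `B` of the boundary. -/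
theorem card_boundary_solutions_le {ι : Type*} [Fintype ι] [DecidableEq ι] [Nontrivial ι]
    (a : ι → ℤ) (ha : ∀ i, a i ≠ 0) (B n : ℕ) :
    ((Fintype.piFinset fun _ : ι => Icc (1 : ℤ) n).filter
      (fun x => ∑ i, a i * x i = 0 ∧ ∃ i, x i ∉ Icc (1 + B : ℤ) (n - B))).card
      ≤ Fintype.card ι * (2 * B * n ^ (Fintype.card ι - 2)) := by
  set S : Finset ℤ := Icc 1 (B : ℤ) ∪ Icc (n - B + 1 : ℤ) n with hS
  have hScard : S.card ≤ 2 * B := by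
    refine (card_union_le _ _).trans ?_
    simp only [Int.card_Icc]
    omega
  have hsub : ((Fintype.piFinset fun _ : ι => Icc (1 : ℤ) n).filter
      (fun x => ∑ i, a i * x i = 0 ∧ ∃ i, x i ∉ Icc (1 + B : ℤ) (n - B)))
      ⊆ univ.biUnion fun i => (Fintype.piFinset
        (Function.update (fun _ : ι => Icc (1 : ℤ) n) i S)).filter
          (fun x => ∑ i, a i * x i = 0) := by
    intro x hx
    obtain ⟨hbox, hsol, i, hi⟩ := mem_filter.1 hx
    rw [Fintype.mem_piFinset] at hbox
    refine mem_biUnion.2 ⟨i, mem_univ i, mem_filter.2 ⟨?_, hsol⟩⟩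
    refine Fintype.mem_piFinset.2 fun l => ?_
    rcases eq_or_ne l i with rfl | h
    · have := hbox l
      simp only [mem_Icc] at this hi
      simp only [Function.update_self, hS, mem_union, mem_Icc]
      omega
    · simpa [Function.update_of_ne h] using hbox l
  refine (card_le_card hsub).trans (card_biUnion_le.trans ?_)
  refine (sum_le_card_nsmul _ _ (2 * B * n ^ (Fintype.card ι - 2)) fun i _ => ?_).trans
    (by simp)
  obtain ⟨j, hj⟩ := exists_ne i
  refine (card_solutions_piFinset_le a j (ha j) _).trans ?_
  rw [← mul_prod_erase (univ.erase j) _ (mem_erase.2 ⟨hj.symm, mem_univ i⟩)]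
  rw [Function.update_self]
  refine Nat.mul_le_mul hScard (le_of_eq ?_)
  rw [prod_congr rfl (g := fun _ => n) fun l hl => by
    rw [Function.update_of_ne (ne_of_mem_erase hl)]; simp]
  rw [prod_const, card_erase_of_mem (mem_erase.2 ⟨hj.symm, mem_univ i⟩),
    card_erase_of_mem (mem_univ j), card_univ]
  rfl

open Finset in
/-- A solution modulo `ℓ` lifts to an integer solution when some coefficient is prime to `ℓ`. -/
theorem exists_int_solution_lift_s2 {ι : Type*} [Fintype ι] [DecidableEq ι] (a : ι → ℤ) (ℓ : ℕ)
    (j : ι) (hcop : Int.gcd (a j) ℓ = 1) (d : ι → ZMod ℓ)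
    (hd : ∑ i, (a i : ZMod ℓ) * d i = 0) :
    ∃ v : ι → ℤ, ∑ i, a i * v i = 0 ∧ ∀ i, (v i : ZMod ℓ) = d i := by
  choose z hz using fun i => ZMod.intCast_surjective (d i)
  obtain ⟨t, ht⟩ : (ℓ : ℤ) ∣ ∑ i, a i * z i := by
    rw [← ZMod.intCast_zmod_eq_zero_iff_dvd]
    push_cast
    simpa only [hz] using hd
  obtain ⟨u, w, huw⟩ := Int.isCoprime_iff_gcd_eq_one.2 hcop
  refine ⟨fun i => u * a j * z i - (if i = j then u * ℓ * t else 0), ?_, fun i => ?_⟩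
  · simp only [mul_sub, sum_sub_distrib, mul_ite, mul_zero, sum_ite_eq', mem_univ, if_true]
    have : ∑ i, a i * (u * a j * z i) = u * a j * ∑ i, a i * z i := by
      rw [mul_sum]
      exact sum_congr rfl fun i _ => by ring
    rw [this, ht]
    ring
  · have h1 : (u : ZMod ℓ) * (a j : ZMod ℓ) = 1 := by
      have := congrArg (Int.cast : ℤ → ZMod ℓ) huw
      simpa using this
    dsimp only
    split_ifs <;> simp [h1, hz]

open Finset in
theorem pow_le_card_zmod_solutions {ι : Type*} [Fintype ι] [DecidableEq ι] (a : ι → ℤ) (ℓ : ℕ)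
    [NeZero ℓ] (j : ι) (hcop : Int.gcd (a j) ℓ = 1) :
    ℓ ^ (Fintype.card ι - 1)
      ≤ (univ.filter (fun x : ι → ZMod ℓ => ∑ i, (a i : ZMod ℓ) * x i = 0)).card := by
  have hcard : (Fintype.piFinset
      (Function.update (fun _ : ι => (univ : Finset (ZMod ℓ))) j {0})).card
      = ℓ ^ (Fintype.card ι - 1) := by
    rw [Fintype.card_piFinset, ← mul_prod_erase univ _ (mem_univ j)]
    simp only [Function.update_self, card_singleton, one_mul]
    rw [prod_congr rfl (g := fun _ => ℓ) fun l hl => by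
      rw [Function.update_of_ne (ne_of_mem_erase hl), card_univ, ZMod.card]]
    rw [prod_const, card_erase_of_mem (mem_univ j), card_univ]
  obtain ⟨u, w, huw⟩ := Int.isCoprime_iff_gcd_eq_one.2 hcop
  have h1 : (u : ZMod ℓ) * (a j : ZMod ℓ) = 1 := by
    have := congrArg (Int.cast : ℤ → ZMod ℓ) huw
    simpa using this
  rw [← hcard]
  refine card_le_card_of_injOn
    (fun t i => t i - (if i = j then (u : ZMod ℓ) * ∑ i, (a i : ZMod ℓ) * t i else 0)) ?_ ?_
  · intro t _
    refine mem_coe.2 (mem_filter.2 ⟨mem_univ _, ?_⟩)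
    simp only [mul_sub, sum_sub_distrib, mul_ite, mul_zero, sum_ite_eq', mem_univ, if_true]
    rw [← mul_assoc, mul_comm (a j : ZMod ℓ), h1, one_mul, sub_self]
  · intro t ht t' ht' htt
    have ht := Fintype.mem_piFinset.1 (mem_coe.1 ht) j
    have ht' := Fintype.mem_piFinset.1 (mem_coe.1 ht') j
    simp only [Function.update_self, mem_singleton] at ht ht'
    funext i
    rcases eq_or_ne i j with rfl | h
    · rw [ht, ht']
    · simpa [h] using congrFun htt i

open Finset in
/-- An equation with coefficients of both signs has at least of order `n ^ (k - 1)` solutions in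
`{1, …, n}`. -/
theorem pow_le_card_solutions {ι : Type*} [Fintype ι] [DecidableEq ι] (a : ι → ℤ)
    (ha : ∀ i, a i ≠ 0) (p q : ι) (hp : 0 < a p) (hq : a q < 0) (s n : ℕ)
    (hn : 2 * (∑ i, |a i|) ^ 2 * s ≤ n) :
    s ^ (Fintype.card ι - 1)
      ≤ ((Fintype.piFinset fun _ : ι => Icc (1 : ℤ) n).filter
          (fun x => ∑ i, a i * x i = 0)).card := by
  set A := ∑ i, |a i| with hA
  have hcard : (Fintype.piFinset
      (Function.update (fun _ : ι => Ico (0 : ℤ) s) p {0})).card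
      = s ^ (Fintype.card ι - 1) := by
    rw [Fintype.card_piFinset, ← mul_prod_erase univ _ (mem_univ p)]
    simp only [Function.update_self, card_singleton, one_mul]
    rw [prod_congr rfl (g := fun _ => s) fun l hl => by
      rw [Function.update_of_ne (ne_of_mem_erase hl)]; simp]
    rw [prod_const, card_erase_of_mem (mem_univ p), card_univ]
  obtain ⟨w, hw, hw1, hwA⟩ : ∃ w : ι → ℤ, ∑ i, a i * w i = 0 ∧ (∀ i, 1 ≤ w i) ∧
      ∀ i, w i ≤ A := by
    have hpos : ∀ i, 0 ≤ (a i)⁺ := fun i => posPart_nonneg _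
    have hneg : ∀ i, 0 ≤ (a i)⁻ := fun i => negPart_nonneg _
    have hpA : ∑ i, (a i)⁺ ≤ A := sum_le_sum fun i _ => by
      have := posPart_add_negPart (a i); have := hneg i; linarith
    have hnA : ∑ i, (a i)⁻ ≤ A := sum_le_sum fun i _ => by
      have := posPart_add_negPart (a i); have := hpos i; linarith
    have hp1 : 1 ≤ ∑ i, (a i)⁺ :=
      le_trans (by rw [posPart_of_nonneg hp.le]; omega)
        (single_le_sum (f := fun i => (a i)⁺) (fun i _ => hpos i) (mem_univ p))
    have hn1 : 1 ≤ ∑ i, (a i)⁻ :=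
      le_trans (by rw [negPart_of_nonpos hq.le]; omega)
        (single_le_sum (f := fun i => (a i)⁻) (fun i _ => hneg i) (mem_univ q))
    refine ⟨fun i => if 0 < a i then ∑ i, (a i)⁻ else ∑ i, (a i)⁺, ?_, fun i => ?_, fun i => ?_⟩
    · have : ∀ i, a i * (if 0 < a i then ∑ i, (a i)⁻ else ∑ i, (a i)⁺)
          = (a i)⁺ * ∑ i, (a i)⁻ - (a i)⁻ * ∑ i, (a i)⁺ := fun i => by
        split_ifs with h
        · rw [posPart_of_nonneg h.le, negPart_of_nonneg h.le]; ring
        · rw [posPart_of_nonpos (not_lt.1 h), negPart_of_nonpos (not_lt.1 h)]; ring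
      rw [sum_congr rfl fun i _ => this i, sum_sub_distrib, ← sum_mul, ← sum_mul]
      ring
    · dsimp only; split_ifs <;> assumption
    · dsimp only; split_ifs <;> assumption
  have hA1 : 1 ≤ A := (hw1 p).trans (hwA p)
  have hai : ∀ i, |a i| ≤ A := fun i =>
    single_le_sum (f := fun i => |a i|) (fun i _ => abs_nonneg _) (mem_univ i)
  rw [← hcard]
  refine card_le_card_of_injOn
    (fun t i => A * s * w i + (a p * t i - (if i = p then ∑ i, a i * t i else 0))) ?_ ?_
  · intro t ht
    have ht := Fintype.mem_piFinset.1 (mem_coe.1 ht)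
    have htp : t p = 0 := by simpa using ht p
    have hts : ∀ i, 0 ≤ t i ∧ (t i ≤ s - 1 ∨ i = p) := fun i => by
      rcases eq_or_ne i p with rfl | h
      · simp [htp]
      · have := ht i
        rw [Function.update_of_ne h, mem_Ico] at this
        exact ⟨this.1, Or.inl (by omega)⟩
    refine mem_coe.2 (mem_filter.2 ⟨Fintype.mem_piFinset.2 fun i => ?_, ?_⟩)
    · have hs : (1 : ℤ) ≤ s := by
        have hqp : q ≠ p := fun h => by rw [h] at hq; omega
        have := hts q
        rcases this with ⟨h0, h1 | h1⟩
        · omega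
        · exact absurd h1 hqp
      have hts' : ∀ i, |t i| ≤ s - 1 := fun i => by
        rw [abs_of_nonneg (hts i).1]
        rcases (hts i).2 with h | rfl
        · exact h
        · rw [htp]; omega
      have hpert : |a p * t i - (if i = p then ∑ i, a i * t i else 0)| ≤ A * (s - 1) := by
        split_ifs with h
        · rw [h, htp, mul_zero, zero_sub, abs_neg, hA, sum_mul]
          refine (abs_sum_le_sum_abs _ _).trans (sum_le_sum fun l _ => ?_)
          rw [abs_mul]
          exact mul_le_mul_of_nonneg_left (hts' l) (abs_nonneg _)
        · rw [sub_zero, abs_mul]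
          exact mul_le_mul (hai p) (hts' i) (abs_nonneg _) (by omega)
      obtain ⟨hlo, hhi⟩ := abs_le.1 hpert
      have hAs : 1 ≤ A * s := by nlinarith
      have hb1 : A * s * 1 ≤ A * s * w i := mul_le_mul_of_nonneg_left (hw1 i) (by omega)
      have hb2 : A * s * w i ≤ A * s * A := mul_le_mul_of_nonneg_left (hwA i) (by omega)
      have hb3 : A * s * 1 ≤ A * s * A := mul_le_mul_of_nonneg_left hA1 (by omega)
      rw [mem_Icc]
      constructor <;> nlinarith
    · simp only [mul_add, mul_sub, sum_add_distrib, sum_sub_distrib, mul_ite, mul_zero,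
        sum_ite_eq', mem_univ, if_true]
      have h1 : ∑ i, a i * (A * s * w i) = A * s * ∑ i, a i * w i := by
        rw [mul_sum]; exact sum_congr rfl fun i _ => by ring
      have h2 : ∑ i, a i * (a p * t i) = a p * ∑ i, a i * t i := by
        rw [mul_sum]; exact sum_congr rfl fun i _ => by ring
      rw [h1, h2, hw]
      ring
  · intro t ht t' ht' htt
    have ht := Fintype.mem_piFinset.1 (mem_coe.1 ht) p
    have ht' := Fintype.mem_piFinset.1 (mem_coe.1 ht') p
    simp only [Function.update_self, mem_singleton] at ht ht'
    funext i
    rcases eq_or_ne i p with rfl | h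
    · rw [ht, ht']
    · have := congrFun htt i
      simp only [h, if_false, sub_zero, add_right_inj] at this
      exact mul_left_cancel₀ (ha p) this

open Finset in
/-- Up to boundary terms, no residue class of solutions is overrepresented among the solutions in
`{1, …, n}`. -/
theorem exists_card_residue_solutions_le {ι : Type*} [Fintype ι] [DecidableEq ι] [Nontrivial ι]
    (a : ι → ℤ) (ha : ∀ i, a i ≠ 0) (ℓ : ℕ) [NeZero ℓ] (hcop : ∀ i, Int.gcd (a i) ℓ = 1) :
    ∃ C : ℕ, ∀ n : ℕ, ∀ y : ι → ZMod ℓ, ∑ i, (a i : ZMod ℓ) * y i = 0 →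
      (ℓ : ℝ) ^ (Fintype.card ι - 1) *
        (((Fintype.piFinset fun _ : ι => Icc (1 : ℤ) n).filter
          (fun x => ∑ i, a i * x i = 0)).filter (fun x => ∀ i, (x i : ZMod ℓ) = y i)).card
      ≤ (((Fintype.piFinset fun _ : ι => Icc (1 : ℤ) n).filter
          (fun x => ∑ i, a i * x i = 0)).card : ℝ)
        + (ℓ : ℝ) ^ (Fintype.card ι - 1) * (C * (n : ℝ) ^ (Fintype.card ι - 2)) := by
  obtain ⟨j⟩ : Nonempty ι := inferInstance
  have hlift : ∀ d : ι → ZMod ℓ, ∃ v : ι → ℤ, ∑ i, (a i : ZMod ℓ) * d i = 0 →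
      ∑ i, a i * v i = 0 ∧ ∀ i, (v i : ZMod ℓ) = d i := fun d => by
    by_cases hd : ∑ i, (a i : ZMod ℓ) * d i = 0
    · obtain ⟨v, hv⟩ := exists_int_solution_lift_s2 a ℓ j (hcop j) d hd
      exact ⟨v, fun _ => hv⟩
    · exact ⟨0, fun h => absurd h hd⟩
  choose v hv using hlift
  set B : ℕ := ∑ d, ∑ i, (v d i).natAbs with hB
  have hvB : ∀ d i, |v d i| ≤ B := fun d i => by
    have h1 : (v d i).natAbs ≤ ∑ i, (v d i).natAbs :=
      single_le_sum (f := fun i => (v d i).natAbs) (fun _ _ => Nat.zero_le _) (mem_univ i)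
    have h2 : ∑ i, (v d i).natAbs ≤ B :=
      single_le_sum (f := fun d => ∑ i, (v d i).natAbs) (fun _ _ => Nat.zero_le _) (mem_univ d)
    rw [Int.abs_eq_natAbs]
    exact_mod_cast h1.trans h2
  refine ⟨Fintype.card ι * (2 * B), fun n y hy => ?_⟩
  set T := (Fintype.piFinset fun _ : ι => Icc (1 : ℤ) n).filter
    (fun x => ∑ i, a i * x i = 0) with hT
  set R := univ.filter (fun x : ι → ZMod ℓ => ∑ i, (a i : ZMod ℓ) * x i = 0) with hR
  set D := Fintype.card ι * (2 * B * n ^ (Fintype.card ι - 2)) with hD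
  have hcmp : ∀ y' ∈ R, (T.filter (fun x => ∀ i, (x i : ZMod ℓ) = y i)).card
      ≤ (T.filter (fun x => (fun i => (x i : ZMod ℓ)) = y')).card + D := fun y' hy' => by
    have hd : ∑ i, (a i : ZMod ℓ) * (y' i - y i) = 0 := by
      simp only [mul_sub, sum_sub_distrib, hy, (mem_filter.1 hy').2, sub_zero]
    obtain ⟨hv0, hvd⟩ := hv (fun i => y' i - y i) hd
    have hvb := hvB (fun i => y' i - y i)
    set u := v (fun i => y' i - y i) with hu
    rw [← card_filter_add_card_filter_not (s := T.filter (fun x => ∀ i, (x i : ZMod ℓ) = y i))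
      (fun x => ∀ i, x i ∈ Icc (1 + B : ℤ) (n - B))]
    refine Nat.add_le_add ?_ ((card_le_card fun x hx => ?_).trans
      (card_boundary_solutions_le a ha B n))
    · refine card_le_card_of_injOn (fun x => x + u) (fun x hx => ?_)
        (fun x _ x' _ h => add_right_cancel h)
      obtain ⟨hx, hin⟩ := mem_filter.1 (mem_coe.1 hx)
      obtain ⟨hxT, hxy⟩ := mem_filter.1 hx
      obtain ⟨_, hsol⟩ := mem_filter.1 hxT
      refine mem_coe.2 (mem_filter.2 ⟨mem_filter.2 ⟨Fintype.mem_piFinset.2 fun i => ?_, ?_⟩, ?_⟩)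
      · have h1 := mem_Icc.1 (hin i)
        have h2 := abs_le.1 (hvb i)
        simp only [mem_Icc, Pi.add_apply]
        omega
      · simp only [Pi.add_apply, mul_add, sum_add_distrib, hsol, hv0, add_zero]
      · funext i
        simp only [Pi.add_apply, Int.cast_add, hxy i, hvd i]
        ring
    · obtain ⟨hx, hin⟩ := mem_filter.1 hx
      obtain ⟨hxT, hxy⟩ := mem_filter.1 hx
      obtain ⟨hbox, hsol⟩ := mem_filter.1 hxT
      exact mem_filter.2 ⟨hbox, hsol, not_forall.1 hin⟩
  have hfib : T.card = ∑ y' ∈ R, (T.filter (fun x => (fun i => (x i : ZMod ℓ)) = y')).card := by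
    refine card_eq_sum_card_fiberwise fun x hx => ?_
    have := congrArg (Int.cast : ℤ → ZMod ℓ) (mem_filter.1 (mem_coe.1 hx)).2
    push_cast at this
    exact mem_coe.2 (mem_filter.2 ⟨mem_univ _, this⟩)
  have hsum := sum_le_sum hcmp
  rw [sum_const, sum_add_distrib, ← hfib, sum_const, smul_eq_mul, smul_eq_mul] at hsum
  have hRle : (ℓ : ℝ) ^ (Fintype.card ι - 1) ≤ R.card := by
    exact_mod_cast pow_le_card_zmod_solutions a ℓ j (hcop j)
  have hRpos : (0 : ℝ) < (ℓ : ℝ) ^ (Fintype.card ι - 1) := by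
    have := NeZero.pos ℓ
    positivity
  have hsumR : (R.card : ℝ) * (T.filter (fun x => ∀ i, (x i : ZMod ℓ) = y i)).card
      ≤ T.card + R.card * D := by exact_mod_cast hsum
  have hDR : ((Fintype.card ι * (2 * B) : ℕ) : ℝ) * (n : ℝ) ^ (Fintype.card ι - 2) = D := by
    rw [hD]; push_cast; ring
  rw [hDR]
  set P := (ℓ : ℝ) ^ (Fintype.card ι - 1)
  set X : ℝ := ((T.filter (fun x => ∀ i, (x i : ZMod ℓ) = y i)).card : ℝ)
  rcases le_total X D with h | h
  · have : (0 : ℝ) ≤ T.card := Nat.cast_nonneg _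
    nlinarith
  · nlinarith

/-- Costello–Elvin comparison lemma: for an odd-length equation with nonzero coefficients,
`limsup_{n→∞} μ_E({1,…,n}) ≤ μ_E(ℤ/ℓℤ)`, where `μ` is the minimum, over all `r`-colorings
of `ℤ/ℓℤ`, of the proportion of monochromatic solutions (the total number of solutions in
`(ℤ/ℓℤ)^k` being `ℓ^(k-1)` since `ℓ` is coprime to every coefficient). -/
theorem limsup_mu_le_mu_zmod
    (m : ℕ) (hm : 1 ≤ m) (k : ℕ) (hk : k = 2 * m + 1)
    (a : Fin k → ℤ) (ha : ∀ i, a i ≠ 0)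
    (r : ℕ) (hr : 2 ≤ r)
    (ℓ : ℕ) [NeZero ℓ] (hℓ : 2 ≤ ℓ) (hcop : ∀ i, Int.gcd (a i) ℓ = 1)
    (μ : ℝ)
    (hμ : IsLeast
      { y : ℝ | ∃ c : ZMod ℓ → Fin r,
        y = ((Finset.univ.filter (fun x : Fin k → ZMod ℓ =>
            (∑ i, (a i : ZMod ℓ) * x i = 0) ∧ ∀ i j, c (x i) = c (x j))).card : ℝ)
          / (ℓ : ℝ) ^ (k - 1) } μ) :
    ∀ ε : ℝ, 0 < ε → ∃ N₀ : ℕ, ∀ n : ℕ, N₀ ≤ n →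
      ∃ c : ℤ → Fin r,
        (((Fintype.piFinset fun _ : Fin k => Finset.Icc (1 : ℤ) n).filter
          (fun x => (∑ i, a i * x i = 0) ∧ ∀ i j, c (x i) = c (x j))).card : ℝ)
        ≤ (μ + ε) *
          (((Fintype.piFinset fun _ : Fin k => Finset.Icc (1 : ℤ) n).filter
            (fun x => ∑ i, a i * x i = 0)).card : ℝ) := by
  intro ε hε
  subst hk
  obtain ⟨⟨c, hc⟩, -⟩ := hμ
  by_cases hmix : (∃ p, 0 < a p) ∧ ∃ q, a q < 0
  swap
  · refine ⟨0, fun n _ => ⟨fun z => c z, ?_⟩⟩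
    have hempty : (Fintype.piFinset fun _ : Fin (2 * m + 1) => Finset.Icc (1 : ℤ) n).filter
        (fun x => ∑ i, a i * x i = 0) = ∅ := by
      refine Finset.filter_eq_empty_iff.2 fun x hx => ?_
      have hx1 : ∀ i, 0 < x i := fun i => by
        have := Finset.mem_Icc.1 (Fintype.mem_piFinset.1 hx i)
        omega
      rw [not_and_or] at hmix
      push Not at hmix
      rcases hmix with h | h
      · exact (Finset.sum_neg (fun i _ => mul_neg_of_neg_of_pos
          (lt_of_le_of_ne (h i) (ha i)) (hx1 i)) Finset.univ_nonempty).ne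
      · exact (Finset.sum_pos (fun i _ => mul_pos
          (lt_of_le_of_ne (h i) (ha i).symm) (hx1 i)) Finset.univ_nonempty).ne'
    rw [← Finset.filter_filter, hempty]
    simp
  obtain ⟨⟨p, hp⟩, q, hq⟩ := hmix
  have : Nontrivial (Fin (2 * m + 1)) := Fin.nontrivial_iff_two_le.2 (by omega)
  obtain ⟨C, hC⟩ := exists_card_residue_solutions_le a ha ℓ hcop
  simp only [Fintype.card_fin] at hC
  set M := Finset.univ.filter (fun x : Fin (2 * m + 1) → ZMod ℓ =>
    (∑ i, (a i : ZMod ℓ) * x i = 0) ∧ ∀ i j, c (x i) = c (x j)) with hM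
  obtain ⟨A, hA⟩ := Int.eq_ofNat_of_zero_le
    (Finset.sum_nonneg fun i (_ : i ∈ Finset.univ) => abs_nonneg (a i))
  have hA1 : 1 ≤ A := by
    have h1 := Finset.single_le_sum (f := fun i => |a i|) (fun i _ => abs_nonneg _)
      (Finset.mem_univ p)
    have h2 := abs_pos.2 (ha p)
    omega
  obtain ⟨s₀, hs₀⟩ := exists_nat_ge (M.card * C * (4 * A ^ 2 : ℝ) ^ (2 * m - 1) / ε)
  refine ⟨2 * A ^ 2 * (s₀ + 1), fun n hn => ⟨fun z => c z, ?_⟩⟩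
  set s := n / (2 * A ^ 2) with hs
  have hA2 : 0 < 2 * A ^ 2 := by positivity
  have hs₀s : s₀ + 1 ≤ s := (Nat.le_div_iff_mul_le hA2).2 (by linarith)
  have hsn : 2 * A ^ 2 * s ≤ n := Nat.mul_div_le n _
  have hns : n ≤ 4 * A ^ 2 * s := by
    have := Nat.lt_mul_div_succ n hA2
    rw [← hs] at this
    nlinarith
  have hTlow := pow_le_card_solutions a ha p q hp hq s n (by rw [hA]; exact_mod_cast hsn)
  rw [Fintype.card_fin] at hTlow
  set T := (Fintype.piFinset fun _ : Fin (2 * m + 1) => Finset.Icc (1 : ℤ) n).filter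
    (fun x => ∑ i, a i * x i = 0) with hT
  rw [← Finset.filter_filter, ← hT]
  have hfib : (T.filter (fun x => ∀ i j, c (x i) = c (x j))).card
      ≤ ∑ y ∈ M, (T.filter (fun x => ∀ i, (x i : ZMod ℓ) = y i)).card := by
    refine (Finset.card_le_card fun x hx => ?_).trans Finset.card_biUnion_le
    obtain ⟨hxT, hxc⟩ := Finset.mem_filter.1 hx
    have hsol := congrArg (Int.cast : ℤ → ZMod ℓ) (Finset.mem_filter.1 hxT).2
    push_cast at hsol
    exact Finset.mem_biUnion.2 ⟨fun i => x i, Finset.mem_filter.2 ⟨Finset.mem_univ _, hsol, hxc⟩,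
      Finset.mem_filter.2 ⟨hxT, fun _ => rfl⟩⟩
  have hℓ0 : (0 : ℝ) < (ℓ : ℝ) ^ (2 * m + 1 - 1) := by
    have := NeZero.pos ℓ
    positivity
  have hy : ∀ y ∈ M, ((T.filter (fun x => ∀ i, (x i : ZMod ℓ) = y i)).card : ℝ)
      ≤ T.card / (ℓ : ℝ) ^ (2 * m + 1 - 1) + C * (n : ℝ) ^ (2 * m + 1 - 2) := fun y hyM => by
    have h := hC n y (Finset.mem_filter.1 hyM).2.1
    rw [← hT] at h
    rw [← mul_le_mul_iff_right₀ hℓ0, mul_add, mul_div_cancel₀ _ hℓ0.ne']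
    refine le_trans (le_of_eq ?_) h
    congr!
  have hmono : ((T.filter (fun x => ∀ i j, c (x i) = c (x j))).card : ℝ)
      ≤ M.card * (T.card / (ℓ : ℝ) ^ (2 * m + 1 - 1) + C * (n : ℝ) ^ (2 * m + 1 - 2)) := by
    have h1 : ((T.filter (fun x => ∀ i j, c (x i) = c (x j))).card : ℝ)
        ≤ ∑ y ∈ M, ((T.filter (fun x => ∀ i, (x i : ZMod ℓ) = y i)).card : ℝ) := by
      exact_mod_cast hfib
    refine h1.trans ((Finset.sum_le_sum hy).trans ?_)
    rw [Finset.sum_const, nsmul_eq_mul]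
  have herr : (M.card : ℝ) * (C * (n : ℝ) ^ (2 * m + 1 - 2)) ≤ ε * T.card := by
    have hT' : (s : ℝ) ^ (2 * m + 1 - 1) ≤ T.card := by exact_mod_cast hTlow
    have hn' : (n : ℝ) ≤ 4 * A ^ 2 * s := by exact_mod_cast hns
    have hs' : (s₀ : ℝ) ≤ s := by exact_mod_cast (Nat.le_succ s₀).trans hs₀s
    have hs'' := (div_le_iff₀ hε).1 (hs₀.trans hs')
    have hpow : (s : ℝ) ^ (2 * m + 1 - 1) = s * (s : ℝ) ^ (2 * m - 1) := by
      rw [← pow_succ']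
      congr 1
      omega
    calc (M.card : ℝ) * (C * (n : ℝ) ^ (2 * m + 1 - 2))
        ≤ M.card * (C * (4 * A ^ 2 * s : ℝ) ^ (2 * m - 1)) := by
          rw [show 2 * m + 1 - 2 = 2 * m - 1 by omega]
          gcongr
      _ = M.card * C * (4 * A ^ 2 : ℝ) ^ (2 * m - 1) * (s : ℝ) ^ (2 * m - 1) := by
          rw [mul_pow (4 * A ^ 2 : ℝ)]
          ring
      _ ≤ s * ε * (s : ℝ) ^ (2 * m - 1) := by gcongr
      _ = ε * (s : ℝ) ^ (2 * m + 1 - 1) := by rw [hpow]; ring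
      _ ≤ ε * T.card := by gcongr
  calc ((T.filter (fun x => ∀ i j, c (x i) = c (x j))).card : ℝ)
      ≤ M.card * (T.card / (ℓ : ℝ) ^ (2 * m + 1 - 1) + C * (n : ℝ) ^ (2 * m + 1 - 2)) := hmono
    _ = μ * T.card + M.card * (C * (n : ℝ) ^ (2 * m + 1 - 2)) := by rw [hc]; ring
    _ ≤ μ * T.card + ε * T.card := by gcongr
    _ = (μ + ε) * T.card := by ring
end
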